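/- Slow rate for the ℓ₁-regularized estimator (Theorem 3.7): Under the sparse RUM with θ* ∈ Θ_{B,k}, suppose Assumption 1 (strong log-concavity with constant γ) holds. For δ ∈ (0,1), set β = (√2 ω H/σ) √((log 2d + log(1/δ))/n), and let θ̂ be any minimizer over Θ_B of ℒ(θ) + β‖θ‖₁. Then with probability at least 1 − δ over the labels, ‖θ̂ − θ*‖_Σ² ≤ (2√2 ω H/γ) · σ · ‖θ*‖₁ · √((log 2d + log(1/δ))/n). -/

import Mathlib

open Finset
open scoped BigOperators RealInnerProductSpace

noncomputable section

/-- Gram matrix `Σ = (1/n) ∑ᵢ zᵢ zᵢᵀ` of the fixed design `z`. -/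
def gram {d n : ℕ} (z : Fin n → EuclideanSpace ℝ (Fin d)) : Matrix (Fin d) (Fin d) ℝ :=
  ((n : ℝ)⁻¹) • ∑ i, Matrix.vecMulVec (fun j => z i j) (fun j => z i j)

/-- The quadratic form `v ↦ vᵀ M v`; for `M = gram z` this is the squared
data-induced semi-norm `‖v‖_Σ²`. -/
def quadForm {d : ℕ} (M : Matrix (Fin d) (Fin d) ℝ) (v : EuclideanSpace ℝ (Fin d)) : ℝ :=
  ∑ i, v i * M.mulVec (fun j => v j) i

/-- The number of non-zero coordinates, i.e. `‖θ‖₀`. -/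
def l0 {d : ℕ} (θ : EuclideanSpace ℝ (Fin d)) : ℕ :=
  (Finset.univ.filter fun j => θ j ≠ 0).card

/-- Joint probability mass of the label vector `y : Fin n → Bool` under the sparse RUM
with parameter `θ` (here `y i = false` encodes `Y_i = 0`, which has probability
`F(⟨θ, z_i⟩/σ)`). -/
def rumPMF {d n : ℕ} (z : Fin n → EuclideanSpace ℝ (Fin d)) (σ : ℝ) (F : ℝ → ℝ)
    (θ : EuclideanSpace ℝ (Fin d)) (y : Fin n → Bool) : ℝ :=
  ∏ i, if y i then 1 - F (⟪θ, z i⟫ / σ) else F (⟪θ, z i⟫ / σ)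

/-- `ζ := (max_{t ∈ [0, m]} F′(t)²) / (F(m)(1 − F(m)))` with `m = BL/σ`. -/
def zeta (F : ℝ → ℝ) (m : ℝ) : ℝ :=
  sSup ((fun t => (deriv F t) ^ 2) '' Set.Icc (0 : ℝ) m) / (F m * (1 - F m))

/-- Negative log-likelihood `ℒ(θ) = −(1/n) ∑ᵢ log F((−1)^{Yᵢ} ⟨θ, zᵢ⟩/σ)`
(`y i = true` encodes `Y_i = 1`). -/
def nll {d n : ℕ} (z : Fin n → EuclideanSpace ℝ (Fin d)) (σ : ℝ) (F : ℝ → ℝ)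
    (y : Fin n → Bool) (θ : EuclideanSpace ℝ (Fin d)) : ℝ :=
  -(1 / (n : ℝ)) * ∑ i, Real.log (F ((if y i then (-1 : ℝ) else 1) * ⟪θ, z i⟫ / σ))

/-- `ω := sup_{t ∈ [−m, m]} F′(t)/F(t)` with `m = BL/σ`. -/
def omegaSup (F : ℝ → ℝ) (m : ℝ) : ℝ :=
  sSup ((fun t => deriv F t / F t) '' Set.Icc (-m) m)

/-- `‖θ‖₁`, the ℓ₁-norm. -/
def l1 {d : ℕ} (θ : EuclideanSpace ℝ (Fin d)) : ℝ := ∑ j, |θ j|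

/-- `H := max_j ‖X_j‖₂/√n`, where `X_j` is the `j`-th column of the design matrix
`X` whose rows are the `zᵢᵀ`. -/
def Hval {d n : ℕ} (z : Fin n → EuclideanSpace ℝ (Fin d)) : ℝ :=
  ⨆ j : Fin d, Real.sqrt (∑ i, z i j ^ 2) / Real.sqrt n

/-- Hoeffding's lemma for a two-point distribution. -/
lemma two_point_exp_le {p q a b c : ℝ} (hp : 0 ≤ p) (hq : 0 ≤ q) (hpq : p + q = 1)
    (hmean : p * a + q * b = 0) (ha : |a| ≤ c) (hb : |b| ≤ c) :
    p * Real.exp a + q * Real.exp b ≤ Real.exp (c ^ 2 / 2) := by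
  have hc : 0 ≤ c := (abs_nonneg a).trans ha
  rcases hc.eq_or_lt with rfl | hc
  · have ha0 : a = 0 := abs_nonpos_iff.mp ha
    have hb0 : b = 0 := abs_nonpos_iff.mp hb
    simp [ha0, hb0, hpq]
  have chord : ∀ x, |x| ≤ c → Real.exp x ≤ Real.cosh c + x / c * Real.sinh c := by
    intro x hx
    have := Real.exp_mul_le_cosh_add_mul_sinh (t := x / c)
      (by rw [abs_div, abs_of_pos hc]; exact (div_le_one hc).2 hx) c
    rwa [div_mul_cancel₀ _ hc.ne'] at this
  calc p * Real.exp a + q * Real.exp b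
      ≤ p * (Real.cosh c + a / c * Real.sinh c) + q * (Real.cosh c + b / c * Real.sinh c) := by
        gcongr
        · exact chord a ha
        · exact chord b hb
    _ = (p + q) * Real.cosh c + (p * a + q * b) / c * Real.sinh c := by ring
    _ = Real.cosh c := by simp [hpq, hmean]
    _ ≤ _ := Real.cosh_le_exp_half_sq c

/-- Hoeffding's inequality for independent bounded functions of Boolean variables. -/
lemma hoeffding_bool {n : ℕ} {p u : Fin n → Bool → ℝ} {c : Fin n → ℝ} {v t ℓ : ℝ}
    (hp : ∀ i b, 0 ≤ p i b) (hp1 : ∀ i, p i true + p i false = 1)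
    (hmean : ∀ i, p i true * u i true + p i false * u i false = 0)
    (hu : ∀ i b, |u i b| ≤ c i) (hv : ∑ i, c i ^ 2 ≤ v) (ht : 0 ≤ t)
    (htv : 2 * v * ℓ ≤ t ^ 2) :
    ∑ y : Fin n → Bool, Set.indicator {y | t < ∑ i, u i (y i)} (fun y => ∏ i, p i (y i)) y
      ≤ Real.exp (-ℓ) := by
  have hv0 : 0 ≤ v := (Finset.sum_nonneg fun i _ => sq_nonneg (c i)).trans hv
  rcases hv0.eq_or_lt with rfl | hv0
  · have hc : ∀ i, c i = 0 := fun i => by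
      have := (Finset.single_le_sum (fun i _ => sq_nonneg (c i)) (Finset.mem_univ i)).trans hv
      exact pow_eq_zero_iff two_ne_zero |>.1 (le_antisymm this (sq_nonneg _))
    have hu0 : ∀ i b, u i b = 0 := fun i b => abs_nonpos_iff.1 ((hu i b).trans (hc i).le)
    simp only [hu0, Finset.sum_const_zero, ht.not_gt]
    simpa using (Real.exp_pos _).le
  calc ∑ y : Fin n → Bool, Set.indicator {y | t < ∑ i, u i (y i)} (fun y => ∏ i, p i (y i)) y
      ≤ ∑ y : Fin n → Bool, Real.exp (-(t / v * t)) *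
          ∏ i, p i (y i) * Real.exp (t / v * u i (y i)) := by
        gcongr with y
        rw [Finset.prod_mul_distrib, ← Real.exp_sum, ← Finset.mul_sum]
        have hP : 0 ≤ ∏ i, p i (y i) := Finset.prod_nonneg fun i _ => hp i _
        by_cases hy : t < ∑ i, u i (y i)
        · rw [Set.indicator_of_mem (s := {y : Fin n → Bool | t < ∑ i, u i (y i)}) hy, mul_left_comm,
            ← Real.exp_add]
          refine le_mul_of_one_le_right hP (Real.one_le_exp ?_)
          have := mul_le_mul_of_nonneg_left hy.le (by positivity : 0 ≤ t / v)
          linarith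
        · rw [Set.indicator_of_notMem (s := {y : Fin n → Bool | t < ∑ i, u i (y i)}) hy]
          positivity
    _ = Real.exp (-(t / v * t)) *
          ∏ i, (p i true * Real.exp (t / v * u i true)
            + p i false * Real.exp (t / v * u i false)) := by
        rw [← Finset.mul_sum]
        congr 1
        rw [← Fintype.piFinset_univ, ← Finset.prod_univ_sum (fun _ => Finset.univ)
          (fun i b => p i b * Real.exp (t / v * u i b))]
        simp
    _ ≤ Real.exp (-(t / v * t)) * ∏ i, Real.exp ((t / v * c i) ^ 2 / 2) := by
        gcongr with i
        · exact fun i _ => add_nonneg (mul_nonneg (hp i _) (Real.exp_pos _).le)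
            (mul_nonneg (hp i _) (Real.exp_pos _).le)
        · have hb : ∀ b, |t / v * u i b| ≤ t / v * c i := fun b => by
            rw [abs_mul, abs_of_nonneg (by positivity : 0 ≤ t / v)]
            exact mul_le_mul_of_nonneg_left (hu i b) (by positivity)
          exact two_point_exp_le (hp i _) (hp i _) (hp1 i)
            (by linear_combination t / v * hmean i) (hb _) (hb _)
    _ = Real.exp (-(t / v * t) + (t / v) ^ 2 * (∑ i, c i ^ 2) / 2) := by
        rw [← Real.exp_sum, ← Real.exp_add]
        congr 2
        rw [← Finset.sum_div, Finset.mul_sum]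
        simp only [mul_pow]
    _ ≤ Real.exp (-ℓ) := by
        apply Real.exp_le_exp.2
        have h1 : (t / v) ^ 2 * (∑ i, c i ^ 2) / 2 ≤ (t / v) ^ 2 * v / 2 := by gcongr
        have h2 : ℓ ≤ t ^ 2 / (2 * v) := by
          rw [le_div_iff₀ (by positivity)]; linarith
        have h3 : -(t / v * t) + (t / v) ^ 2 * v / 2 = -(t ^ 2 / (2 * v)) := by
          field_simp; ring
        linarith

/-- Quadratic lower bound on `-log F` at any point of an interval on which `F` is strongly
log-concave. -/
lemma neg_log_quadratic_lower_bound {F : ℝ → ℝ} {S : Set ℝ} {γ x y : ℝ} (hS : Convex ℝ S)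
    (hpos : ∀ t ∈ S, 0 < F t)
    (hF : Differentiable ℝ F) (hF' : Differentiable ℝ (deriv F))
    (hlc : ∀ t ∈ S, 2 * γ ≤ deriv (deriv fun s => -Real.log (F s)) t)
    (hx : x ∈ S) (hy : y ∈ S) :
    -Real.log (F x) - deriv F x / F x * (y - x) + γ * (y - x) ^ 2 ≤ -Real.log (F y) := by
  have hderiv : ∀ t, 0 < F t →
      HasDerivAt (fun s => -Real.log (F s)) (-(deriv F t / F t)) t := fun t ht =>
    ((hF t).hasDerivAt.log ht.ne').neg
  have hg : ∀ t, 0 < F t →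
      HasDerivAt (fun s => -Real.log (F s) - γ * s ^ 2) (-(deriv F t / F t) - 2 * γ * t) t := by
    intro t ht
    convert! (hderiv t ht).sub ((hasDerivAt_pow 2 t).const_mul γ) using 1
    ring
  have hg' : ∀ t, 0 < F t → HasDerivAt (fun s => -(deriv F s / F s) - 2 * γ * s)
      (deriv (deriv fun s => -Real.log (F s)) t - 2 * γ) t := by
    intro t ht
    have hev : (deriv fun s => -Real.log (F s)) =ᶠ[nhds t] fun s => -(deriv F s / F s) :=
      (hF.continuous.continuousAt.eventually (lt_mem_nhds ht)).mono fun s hs =>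
        (hderiv s hs).deriv
    have hd : DifferentiableAt ℝ (fun s => -(deriv F s / F s)) t :=
      ((hF' t).div (hF t) ht.ne').neg
    rw [hev.deriv_eq]
    convert! hd.hasDerivAt.sub ((hasDerivAt_id t).const_mul (2 * γ)) using 1
    ring
  have hconv : ConvexOn ℝ S fun s => -Real.log (F s) - γ * s ^ 2 :=
    convexOn_of_hasDerivWithinAt2_nonneg hS
      (fun t ht => (hg t (hpos t ht)).continuousAt.continuousWithinAt)
      (fun t ht => (hg t (hpos t (interior_subset ht))).hasDerivWithinAt)
      (fun t ht => (hg' t (hpos t (interior_subset ht))).hasDerivWithinAt)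
      (fun t ht => by linarith [hlc t (interior_subset ht)])
  rcases lt_trichotomy x y with hxy | rfl | hxy
  · have h := hconv.le_slope_of_hasDerivAt hx hy hxy (hg x (hpos x hx))
    rw [slope_def_field, le_div_iff₀ (sub_pos.2 hxy)] at h
    nlinarith
  · simp
  · have h := hconv.slope_le_of_hasDerivAt hy hx hxy (hg x (hpos x hx))
    rw [slope_def_field, div_le_iff₀ (sub_pos.2 hxy)] at h
    nlinarith

lemma quadForm_gram {d n : ℕ} (z : Fin n → EuclideanSpace ℝ (Fin d))
    (v : EuclideanSpace ℝ (Fin d)) :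
    quadForm (gram z) v = (n : ℝ)⁻¹ * ∑ i, ⟪v, z i⟫ ^ 2 := by
  have hinner : ∀ i, ⟪v, z i⟫ = ∑ j, v j * z i j := fun i => by
    simp [PiLp.inner_apply, mul_comm]
  calc quadForm (gram z) v
      = ∑ j, ∑ l, ∑ i, (n : ℝ)⁻¹ * ((v j * z i j) * (v l * z i l)) := by
        simp only [quadForm, gram, Matrix.mulVec, dotProduct, Matrix.smul_apply,
          Matrix.sum_apply, Matrix.vecMulVec_apply, smul_eq_mul, Finset.mul_sum, Finset.sum_mul]
        refine Finset.sum_congr rfl fun j _ => Finset.sum_congr rfl fun l _ =>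
          Finset.sum_congr rfl fun i _ => by ring
    _ = ∑ i, ∑ j, ∑ l, (n : ℝ)⁻¹ * ((v j * z i j) * (v l * z i l)) := by
        rw [Finset.sum_comm (s := (Finset.univ : Finset (Fin n)))]
        exact Finset.sum_congr rfl fun j _ => Finset.sum_comm
    _ = _ := by
        simp only [hinner, sq, Finset.sum_mul_sum]
        simp only [Finset.mul_sum]

lemma l1_sub_le {d : ℕ} (θ θ' : EuclideanSpace ℝ (Fin d)) : l1 (θ - θ') ≤ l1 θ + l1 θ' := by
  simp only [l1, ← Finset.sum_add_distrib]
  exact Finset.sum_le_sum fun j _ => abs_sub (θ j) (θ' j)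

lemma Hval_nonneg {d n : ℕ} (z : Fin n → EuclideanSpace ℝ (Fin d)) : 0 ≤ Hval z :=
  Real.iSup_nonneg fun _ => by positivity

lemma sum_sq_le_Hval {d n : ℕ} (hn : 0 < n) (z : Fin n → EuclideanSpace ℝ (Fin d)) (j : Fin d) :
    ∑ i, z i j ^ 2 ≤ n * Hval z ^ 2 := by
  have hn' : (0 : ℝ) < n := by exact_mod_cast hn
  have h : Real.sqrt (∑ i, z i j ^ 2) / Real.sqrt n ≤ Hval z :=
    le_ciSup (f := fun j : Fin d => Real.sqrt (∑ i, z i j ^ 2) / Real.sqrt n)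
      (Set.finite_range _).bddAbove j
  have h2 := pow_le_pow_left₀ (by positivity) h 2
  rw [div_pow, Real.sq_sqrt (Finset.sum_nonneg fun i _ => sq_nonneg _), Real.sq_sqrt hn'.le,
    div_le_iff₀ hn'] at h2
  linarith

/-- Derivative at `x` of the negative log-likelihood of a single label `b`. -/
def score (F : ℝ → ℝ) (x : ℝ) (b : Bool) : ℝ :=
  -((if b then (-1 : ℝ) else 1) *
    (deriv F ((if b then (-1 : ℝ) else 1) * x) / F ((if b then (-1 : ℝ) else 1) * x)))

lemma sign_mul_mem_Icc {m x : ℝ} (hx : x ∈ Set.Icc (-m) m) (b : Bool) :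
    (if b then (-1 : ℝ) else 1) * x ∈ Set.Icc (-m) m := by
  obtain ⟨h1, h2⟩ := hx
  cases b <;> constructor <;> simp <;> linarith

lemma deriv_neg_of_symm {F : ℝ → ℝ} (hF : Differentiable ℝ F) (hsymm : ∀ t, F t = 1 - F (-t))
    (x : ℝ) : deriv F (-x) = deriv F x := by
  have h : HasDerivAt (fun t => 1 - F (-t)) (deriv F (-x)) x := by
    have := ((hF (-x)).hasDerivAt.comp x (hasDerivAt_neg x)).const_sub 1
    simpa using this
  rw [← funext hsymm] at h
  exact h.deriv.symm

lemma score_mean_zero {F : ℝ → ℝ} (hF : Differentiable ℝ F) (hsymm : ∀ t, F t = 1 - F (-t))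
    {x : ℝ} (h0 : 0 < F x) (h1 : F x < 1) :
    (1 - F x) * score F x true + F x * score F x false = 0 := by
  have hneg : F (-x) = 1 - F x := by linarith [hsymm x]
  have h1' : 1 - F x ≠ 0 := by linarith
  simp only [score, if_true, Bool.false_eq_true, if_false, neg_one_mul, one_mul, hneg,
    deriv_neg_of_symm hF hsymm]
  field_simp
  ring

lemma omegaSup_nonneg {F : ℝ → ℝ} {m : ℝ} (hmono : Monotone F)
    (hpos : ∀ t ∈ Set.Icc (-m) m, 0 < F t) : 0 ≤ omegaSup F m := by
  refine Real.sSup_nonneg ?_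
  rintro _ ⟨t, ht, rfl⟩
  exact div_nonneg hmono.deriv_nonneg (hpos t ht).le

lemma abs_score_le {F : ℝ → ℝ} {m x : ℝ} (hmono : Monotone F)
    (hpos : ∀ t ∈ Set.Icc (-m) m, 0 < F t)
    (hbdd : BddAbove ((fun t => deriv F t / F t) '' Set.Icc (-m) m))
    (hx : x ∈ Set.Icc (-m) m) (b : Bool) : |score F x b| ≤ omegaSup F m := by
  have hm := sign_mul_mem_Icc hx b
  have hle := le_csSup hbdd (Set.mem_image_of_mem _ hm)
  have h0 : 0 ≤ deriv F ((if b then (-1 : ℝ) else 1) * x) / F ((if b then (-1 : ℝ) else 1) * x) :=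
    div_nonneg hmono.deriv_nonneg (hpos _ hm).le
  rw [score, abs_neg, abs_mul, abs_of_nonneg h0]
  have hs : |if b then (-1 : ℝ) else 1| = 1 := by cases b <;> simp
  rw [hs, one_mul]
  exact hle

lemma inner_div_mem_Icc {d : ℕ} {θ w : EuclideanSpace ℝ (Fin d)} {B L σ : ℝ} (hσ : 0 < σ)
    (hθ : ‖θ‖ ≤ B) (hw : ‖w‖ ≤ L) : ⟪θ, w⟫ / σ ∈ Set.Icc (-(B * L / σ)) (B * L / σ) := by
  rw [Set.mem_Icc, ← abs_le, abs_div, abs_of_pos hσ]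
  gcongr
  exact (abs_real_inner_le_norm θ w).trans
    (mul_le_mul hθ hw (norm_nonneg _) ((norm_nonneg _).trans hθ))

/-- Strong convexity of the negative log-likelihood in the data-induced semi-norm. -/
lemma nll_quadratic_lower_bound {d n : ℕ} {z : Fin n → EuclideanSpace ℝ (Fin d)}
    {B L σ γ : ℝ} {F : ℝ → ℝ} (hσ : 0 < σ) (hz : ∀ i, ‖z i‖ ≤ L)
    (hpos : ∀ t ∈ Set.Icc (-(B * L / σ)) (B * L / σ), 0 < F t)
    (hF : Differentiable ℝ F) (hF' : Differentiable ℝ (deriv F))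
    (hlc : ∀ t ∈ Set.Icc (-(B * L / σ)) (B * L / σ),
      2 * γ ≤ deriv (deriv fun s => -Real.log (F s)) t)
    {θ θ' : EuclideanSpace ℝ (Fin d)} (hθ : ‖θ‖ ≤ B) (hθ' : ‖θ'‖ ≤ B) (y : Fin n → Bool) :
    nll z σ F y θ + (n * σ)⁻¹ * ∑ j, (θ' - θ) j * ∑ i, score F (⟪θ, z i⟫ / σ) (y i) * z i j
      + γ / σ ^ 2 * quadForm (gram z) (θ' - θ) ≤ nll z σ F y θ' := by
  have hterm : ∀ i,
      -Real.log (F ((if y i then (-1 : ℝ) else 1) * ⟪θ, z i⟫ / σ))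
        + σ⁻¹ * (score F (⟪θ, z i⟫ / σ) (y i) * ⟪θ' - θ, z i⟫)
        + γ / σ ^ 2 * ⟪θ' - θ, z i⟫ ^ 2
      ≤ -Real.log (F ((if y i then (-1 : ℝ) else 1) * ⟪θ', z i⟫ / σ)) := by
    intro i
    have h := neg_log_quadratic_lower_bound (convex_Icc _ _) hpos hF hF' hlc
      (sign_mul_mem_Icc (inner_div_mem_Icc hσ hθ (hz i)) (y i))
      (sign_mul_mem_Icc (inner_div_mem_Icc hσ hθ' (hz i)) (y i))
    rw [inner_sub_left, mul_div_assoc, mul_div_assoc, score]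
    refine le_trans (le_of_eq ?_) h
    have hs : (if y i then (-1 : ℝ) else 1) ^ 2 = 1 := by cases y i <;> simp
    generalize (if y i then (-1 : ℝ) else 1) = s at *
    have e : γ * (s * (⟪θ', z i⟫ / σ) - s * (⟪θ, z i⟫ / σ)) ^ 2
        = γ / σ ^ 2 * (⟪θ', z i⟫ - ⟪θ, z i⟫) ^ 2 := by
      rw [← mul_sub, mul_pow, hs]
      field_simp
    rw [e]
    ring
  have hsum := Finset.sum_le_sum fun i (_ : i ∈ Finset.univ) => hterm i
  have hswap : ∑ j, (θ' - θ) j * ∑ i, score F (⟪θ, z i⟫ / σ) (y i) * z i j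
      = ∑ i, score F (⟪θ, z i⟫ / σ) (y i) * ⟪θ' - θ, z i⟫ := by
    simp only [Finset.mul_sum, PiLp.inner_apply]
    rw [Finset.sum_comm]
    refine Finset.sum_congr rfl fun i _ => Finset.sum_congr rfl fun j _ => ?_
    simp only [RCLike.inner_apply, conj_trivial]
    ring
  have hmul := mul_le_mul_of_nonneg_left hsum (inv_nonneg.2 (Nat.cast_nonneg (α := ℝ) n))
  rw [hswap, quadForm_gram, nll, nll]
  simp only [Finset.sum_add_distrib, ← Finset.mul_sum, Finset.sum_neg_distrib] at hmul
  rw [mul_inv, one_div]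
  linarith

/-- Basic inequality for the `ℓ₁`-penalized minimizer when the penalty dominates the gradient of
the negative log-likelihood at the true parameter. -/
lemma quadForm_le_of_score_le {d n : ℕ} {z : Fin n → EuclideanSpace ℝ (Fin d)}
    {B L σ γ β : ℝ} {F : ℝ → ℝ} (hn : 0 < n) (hσ : 0 < σ) (hγ : 0 < γ) (hz : ∀ i, ‖z i‖ ≤ L)
    (hpos : ∀ t ∈ Set.Icc (-(B * L / σ)) (B * L / σ), 0 < F t)
    (hF : Differentiable ℝ F) (hF' : Differentiable ℝ (deriv F))
    (hlc : ∀ t ∈ Set.Icc (-(B * L / σ)) (B * L / σ),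
      2 * γ ≤ deriv (deriv fun s => -Real.log (F s)) t)
    {θ θ' : EuclideanSpace ℝ (Fin d)} (hθ : ‖θ‖ ≤ B) (hθ' : ‖θ'‖ ≤ B) {y : Fin n → Bool}
    (hβ : 0 ≤ β) (hmin : nll z σ F y θ' + β * l1 θ' ≤ nll z σ F y θ + β * l1 θ)
    (hscore : ∀ j, |∑ i, score F (⟪θ, z i⟫ / σ) (y i) * z i j| ≤ n * σ * β) :
    quadForm (gram z) (θ' - θ) ≤ 2 * β * σ ^ 2 / γ * l1 θ := by
  have hn' : (0 : ℝ) < n := by exact_mod_cast hn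
  have hlow := nll_quadratic_lower_bound hσ hz hpos hF hF' hlc hθ hθ' y
  have hgrad : -(β * l1 (θ' - θ)) ≤
      (n * σ)⁻¹ * ∑ j, (θ' - θ) j * ∑ i, score F (⟪θ, z i⟫ / σ) (y i) * z i j := by
    have h : -(n * σ * β * l1 (θ' - θ)) ≤
        ∑ j, (θ' - θ) j * ∑ i, score F (⟪θ, z i⟫ / σ) (y i) * z i j := by
      rw [l1, Finset.mul_sum, ← Finset.sum_neg_distrib]
      refine Finset.sum_le_sum fun j _ => ?_
      have h1 := neg_abs_le ((θ' - θ) j * ∑ i, score F (⟪θ, z i⟫ / σ) (y i) * z i j)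
      rw [abs_mul] at h1
      have h2 := mul_le_mul_of_nonneg_left (hscore j) (abs_nonneg ((θ' - θ) j))
      linarith
    have h3 := mul_le_mul_of_nonneg_left h (by positivity : 0 ≤ (n * σ : ℝ)⁻¹)
    refine le_trans (le_of_eq ?_) h3
    field_simp
  have htri := mul_le_mul_of_nonneg_left (l1_sub_le θ' θ) hβ
  have hmain : γ / σ ^ 2 * quadForm (gram z) (θ' - θ) ≤ 2 * β * l1 θ := by linarith
  have h := mul_le_mul_of_nonneg_left hmain (by positivity : 0 ≤ σ ^ 2 / γ)
  calc quadForm (gram z) (θ' - θ) = σ ^ 2 / γ * (γ / σ ^ 2 * quadForm (gram z) (θ' - θ)) := by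
        field_simp
    _ ≤ _ := h
    _ = _ := by ring

lemma rumPMF_eq_prod {d n : ℕ} (z : Fin n → EuclideanSpace ℝ (Fin d)) (σ : ℝ) (F : ℝ → ℝ)
    (θ : EuclideanSpace ℝ (Fin d)) :
    rumPMF z σ F θ = fun y => ∏ i, (fun (i : Fin n) (b : Bool) =>
      if b then 1 - F (⟪θ, z i⟫ / σ) else F (⟪θ, z i⟫ / σ)) i (y i) := rfl

lemma sum_rumPMF {d n : ℕ} (z : Fin n → EuclideanSpace ℝ (Fin d)) (σ : ℝ) (F : ℝ → ℝ)
    (θ : EuclideanSpace ℝ (Fin d)) : ∑ y, rumPMF z σ F θ y = 1 := by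
  rw [rumPMF_eq_prod, ← Fintype.piFinset_univ, ← Finset.prod_univ_sum (fun _ => Finset.univ)
    (fun (i : Fin n) (b : Bool) => if b then 1 - F (⟪θ, z i⟫ / σ) else F (⟪θ, z i⟫ / σ))]
  simp

lemma rumPMF_nonneg {d n : ℕ} {z : Fin n → EuclideanSpace ℝ (Fin d)} {σ : ℝ} {F : ℝ → ℝ}
    {θ : EuclideanSpace ℝ (Fin d)}
    (h : ∀ i, 0 ≤ F (⟪θ, z i⟫ / σ) ∧ F (⟪θ, z i⟫ / σ) ≤ 1) (y : Fin n → Bool) :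
    0 ≤ rumPMF z σ F θ y := by
  refine Finset.prod_nonneg fun i _ => ?_
  split_ifs
  · linarith [(h i).2]
  · exact (h i).1

/-- Two-sided union bound for finitely many real statistics. -/
lemma sum_indicator_union_bound {α ι : Type*} [Fintype α] [Fintype ι] {P : α → ℝ}
    {S : ι → α → ℝ} {t ε : ℝ} (hP : ∀ a, 0 ≤ P a) (hP1 : ∑ a, P a = 1)
    (hup : ∀ j, ∑ a, Set.indicator {a | t < S j a} P a ≤ ε)
    (hlow : ∀ j, ∑ a, Set.indicator {a | t < -S j a} P a ≤ ε) :
    1 - Fintype.card ι * (2 * ε) ≤ ∑ a, Set.indicator {a | ∀ j, |S j a| ≤ t} P a := by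
  have hpt : ∀ a, P a ≤ Set.indicator {a | ∀ j, |S j a| ≤ t} P a
      + ∑ j, (Set.indicator {a | t < S j a} P a + Set.indicator {a | t < -S j a} P a) := by
    intro a
    have hnn : ∀ s : Set α, 0 ≤ Set.indicator s P a := fun s =>
      Set.indicator_nonneg (fun a _ => hP a) a
    have hnn' : ∀ j, 0 ≤ Set.indicator {a | t < S j a} P a
        + Set.indicator {a | t < -S j a} P a := fun j => add_nonneg (hnn _) (hnn _)
    by_cases ha : ∀ j, |S j a| ≤ t
    · rw [Set.indicator_of_mem (s := {a | ∀ j, |S j a| ≤ t}) ha]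
      exact le_add_of_nonneg_right (Finset.sum_nonneg fun j _ => hnn' j)
    · push Not at ha
      obtain ⟨j, hj⟩ := ha
      refine le_trans ?_ (le_add_of_nonneg_left (hnn _))
      refine le_trans ?_ (Finset.single_le_sum (fun j _ => hnn' j) (Finset.mem_univ j))
      rcases lt_abs.1 hj with h | h
      · rw [Set.indicator_of_mem (s := {a | t < S j a}) h]
        exact le_add_of_nonneg_right (hnn _)
      · rw [Set.indicator_of_mem (s := {a | t < -S j a}) h]
        exact le_add_of_nonneg_left (hnn _)
  have hsum := Finset.sum_le_sum fun a (_ : a ∈ Finset.univ) => hpt a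
  rw [hP1, Finset.sum_add_distrib, Finset.sum_comm] at hsum
  have hbd : ∑ j, ∑ a, (Set.indicator {a | t < S j a} P a + Set.indicator {a | t < -S j a} P a)
      ≤ Fintype.card ι * (2 * ε) := by
    refine (Finset.sum_le_card_nsmul _ _ (2 * ε) fun j _ => ?_).trans_eq (by simp)
    rw [Finset.sum_add_distrib]
    linarith [hup j, hlow j]
  linarith

/-- **Theorem 3.7 (Slow rate for the ℓ₁-regularized estimator).**
Under the sparse RUM with strong log-concavity (Assumption 1), the
ℓ₁-regularized estimator with penalty `β = (√2 ω H/σ)√((log 2d + log(1/δ))/n)`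
satisfies, with probability at least `1 − δ`,
`‖θ̂ − θ*‖_Σ² ≤ (2√2 ω H/γ) σ ‖θ*‖₁ √((log 2d + log(1/δ))/n)`. -/
theorem l1_regularized_slow_rate
    (d n k : ℕ) (z : Fin n → EuclideanSpace ℝ (Fin d)) (B L σ γ : ℝ) (F : ℝ → ℝ)
    (hd : 0 < d) (hn : 0 < n) (hB : 0 < B) (hσ : 0 < σ) (hγ : 0 < γ)
    (hz : ∀ i, ‖z i‖ ≤ L)
    (hF01 : ∀ t ∈ Set.Icc (-(B * L / σ)) (B * L / σ), 0 < F t ∧ F t < 1)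
    (hFsymm : ∀ t, F t = 1 - F (-t))
    (hFmono : Monotone F)
    (hFdiff : Differentiable ℝ F) (hFdiff2 : Differentiable ℝ (deriv F))
    -- Assumption 1: strong log-concavity of `F` on `[−BL/σ, BL/σ]`
    (hlogccv : ∀ t ∈ Set.Icc (-(B * L / σ)) (B * L / σ),
      2 * γ ≤ deriv (deriv fun s => -Real.log (F s)) t)
    (hωbdd : BddAbove ((fun t => deriv F t / F t) '' Set.Icc (-(B * L / σ)) (B * L / σ)))
    -- ground-truth parameter `θ* ∈ Θ_{B,k}`
    (θstar : EuclideanSpace ℝ (Fin d)) (hθB : ‖θstar‖ ≤ B) (hθ0 : l0 θstar ≤ k)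
    (δ : ℝ) (hδ0 : 0 < δ) (hδ1 : δ < 1)
    -- the regularization parameter
    (β : ℝ)
    (hβ : β = Real.sqrt 2 * omegaSup F (B * L / σ) * Hval z / σ *
      Real.sqrt ((Real.log (2 * d) + Real.log (1 / δ)) / n))
    -- `θ̂` is, for each realization of the labels, a minimizer of
    -- `ℒ(θ) + β‖θ‖₁` over `Θ_B`
    (θhat : (Fin n → Bool) → EuclideanSpace ℝ (Fin d))
    (hhatmem : ∀ y, ‖θhat y‖ ≤ B)
    (hhatmin : ∀ y, ∀ θ : EuclideanSpace ℝ (Fin d), ‖θ‖ ≤ B →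
      nll z σ F y (θhat y) + β * l1 (θhat y) ≤ nll z σ F y θ + β * l1 θ) :
    1 - δ ≤ ∑ y, Set.indicator
        {y : Fin n → Bool |
          quadForm (gram z) (θhat y - θstar) ≤
            2 * Real.sqrt 2 * omegaSup F (B * L / σ) * Hval z / γ * σ * l1 θstar *
              Real.sqrt ((Real.log (2 * d) + Real.log (1 / δ)) / n)}
        (rumPMF z σ F θstar) y := by
  have hn' : (0 : ℝ) < n := by exact_mod_cast hn
  have hd1 : (1 : ℝ) ≤ d := by exact_mod_cast hd
  set ℓ := Real.log (2 * d) + Real.log (1 / δ) with hℓ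
  have hℓ0 : 0 ≤ ℓ := add_nonneg (Real.log_nonneg (by linarith))
    (Real.log_nonneg ((one_le_div hδ0).2 hδ1.le))
  have hpos : ∀ t ∈ Set.Icc (-(B * L / σ)) (B * L / σ), 0 < F t := fun t ht => (hF01 t ht).1
  have hω := omegaSup_nonneg hFmono hpos
  have hH := Hval_nonneg z
  have hmem : ∀ i, ⟪θstar, z i⟫ / σ ∈ Set.Icc (-(B * L / σ)) (B * L / σ) := fun i =>
    inner_div_mem_Icc hσ hθB (hz i)
  set ω := omegaSup F (B * L / σ)
  set H := Hval z
  have hβ0 : 0 ≤ β := by rw [hβ]; positivity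
  have hβsq : 2 * (ω ^ 2 * (n * H ^ 2)) * ℓ = (n * σ * β) ^ 2 := by
    rw [hβ]
    simp only [mul_pow, div_pow]
    rw [Real.sq_sqrt (by positivity), Real.sq_sqrt (by positivity)]
    field_simp
  have hexp : Real.exp (-ℓ) = δ / (2 * d) := by
    rw [hℓ, neg_add, Real.exp_add, Real.exp_neg, Real.exp_neg, Real.exp_log (by positivity),
      Real.exp_log (by positivity)]
    field_simp
  have hPnn : ∀ y, 0 ≤ rumPMF z σ F θstar y :=
    rumPMF_nonneg fun i => ⟨(hF01 _ (hmem i)).1.le, (hF01 _ (hmem i)).2.le⟩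
  have htail : ∀ (s : ℝ), |s| = 1 → ∀ j, ∑ y, Set.indicator
      {y : Fin n → Bool | n * σ * β < ∑ i, s * (score F (⟪θstar, z i⟫ / σ) (y i) * z i j)}
      (rumPMF z σ F θstar) y ≤ δ / (2 * d) := by
    intro s hs j
    rw [← hexp, rumPMF_eq_prod]
    refine hoeffding_bool
      (p := fun i b => if b then 1 - F (⟪θstar, z i⟫ / σ) else F (⟪θstar, z i⟫ / σ))
      (c := fun i => ω * |z i j|) (v := ω ^ 2 * (n * H ^ 2))
      (u := fun i b => s * (score F (⟪θstar, z i⟫ / σ) b * z i j))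
      ?_ ?_ ?_ ?_ ?_ (by positivity) hβsq.le
    · intro i b
      have := hF01 _ (hmem i)
      cases b <;> simp <;> linarith
    · intro i
      simp
    · intro i
      have := score_mean_zero hFdiff hFsymm (hF01 _ (hmem i)).1 (hF01 _ (hmem i)).2
      simp only [if_true, Bool.false_eq_true, if_false]
      linear_combination s * z i j * this
    · intro i b
      rw [abs_mul, hs, one_mul, abs_mul]
      exact mul_le_mul_of_nonneg_right (abs_score_le hFmono hpos hωbdd (hmem i) b) (abs_nonneg _)
    · simp only [mul_pow, sq_abs, ← Finset.mul_sum]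
      exact mul_le_mul_of_nonneg_left (sum_sq_le_Hval hn z j) (sq_nonneg _)
  have hunion := sum_indicator_union_bound
    (S := fun (j : Fin d) (y : Fin n → Bool) => ∑ i, score F (⟪θstar, z i⟫ / σ) (y i) * z i j)
    hPnn (sum_rumPMF z σ F θstar)
    (fun j => by simpa using htail 1 (by simp) j)
    (fun j => by simpa using htail (-1) (by simp) j)
  have hδ : (Fintype.card (Fin d) : ℝ) * (2 * (δ / (2 * d))) = δ := by
    rw [Fintype.card_fin]
    field_simp
  rw [hδ] at hunion
  refine hunion.trans (Finset.sum_le_sum fun y _ => ?_)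
  refine Set.indicator_le_indicator_of_subset (fun y hy => ?_) hPnn y
  refine (quadForm_le_of_score_le hn hσ hγ hz hpos hFdiff hFdiff2 hlogccv hθB (hhatmem y) hβ0
    (hhatmin y θstar hθB) hy).trans_eq ?_
  rw [hβ]
  field_simp
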